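/- For every weight triple (p₁,p₂,p₃), in 𝕃(p₁,p₂,p₃) one has 2ω⃗ + c⃗ = (p₁−2)x⃗₁ + (p₂−2)x⃗₂ + (p₃−2)x⃗₃, and the interval {x ∈ 𝕃 : 0 ≤ x ≤ 2ω⃗ + c⃗} equals {l₁x⃗₁ + l₂x⃗₂ + l₃x⃗₃ : 0 ≤ lᵢ ≤ pᵢ − 2 for i = 1,2,3}. -/

import Mathlib

/-- The subgroup of relations defining the group `𝕃(p₁,p₂,p₃)`: `ℤ³` modulo the
subgroup generated by `p₁e₁ − p₂e₂` and `p₂e₂ − p₃e₃`. -/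
def wplRel (p : Fin 3 → ℕ) : AddSubgroup (Fin 3 → ℤ) :=
  AddSubgroup.closure
    { (p 0 : ℤ) • Pi.single (0 : Fin 3) (1 : ℤ) - (p 1 : ℤ) • Pi.single (1 : Fin 3) (1 : ℤ),
      (p 1 : ℤ) • Pi.single (1 : Fin 3) (1 : ℤ) - (p 2 : ℤ) • Pi.single (2 : Fin 3) (1 : ℤ) }

/-- The rank-one abelian group `𝕃(p₁,p₂,p₃)` with generators `x⃗₁, x⃗₂, x⃗₃` and relations
`p₁x⃗₁ = p₂x⃗₂ = p₃x⃗₃`. -/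
abbrev WPLGroup (p : Fin 3 → ℕ) : Type := (Fin 3 → ℤ) ⧸ wplRel p

/-- The generator `x⃗ᵢ` of `𝕃(p₁,p₂,p₃)` (class of the standard basis vector `eᵢ`). -/
def wplX (p : Fin 3 → ℕ) (i : Fin 3) : WPLGroup p :=
  QuotientAddGroup.mk (Pi.single i 1)

/-- The canonical element `c⃗ = p₁x⃗₁` of `𝕃(p₁,p₂,p₃)`. -/
def wplC (p : Fin 3 → ℕ) : WPLGroup p := (p 0 : ℤ) • wplX p 0

/-- The dualizing element `ω⃗ = c⃗ − x⃗₁ − x⃗₂ − x⃗₃` of `𝕃(p₁,p₂,p₃)`. -/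
def wplOmega (p : Fin 3 → ℕ) : WPLGroup p :=
  wplC p - wplX p 0 - wplX p 1 - wplX p 2

/-- The positive cone `𝕃₊`: the submonoid of `𝕃(p₁,p₂,p₃)` generated by `x⃗₁, x⃗₂, x⃗₃`. -/
def wplPos (p : Fin 3 → ℕ) : AddSubmonoid (WPLGroup p) :=
  AddSubmonoid.closure {wplX p 0, wplX p 1, wplX p 2}

theorem wplPos_iff (p : Fin 3 → ℕ) (x : WPLGroup p) : x ∈ wplPos p ↔
    ∃ a b c : ℤ, 0 ≤ a ∧ 0 ≤ b ∧ 0 ≤ c ∧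
      x = a • wplX p 0 + b • wplX p 1 + c • wplX p 2 := by
  constructor
  · intro h
    unfold wplPos at h
    induction h using AddSubmonoid.closure_induction with
    | mem x hx =>
      rcases hx with rfl | rfl | rfl
      · exact ⟨1, 0, 0, by simp⟩
      · exact ⟨0, 1, 0, by simp⟩
      · exact ⟨0, 0, 1, by simp⟩
    | zero => exact ⟨0, 0, 0, by simp⟩
    | add x y _ _ hx hy =>
      obtain ⟨a, b, c, ha, hb, hc, rfl⟩ := hx
      obtain ⟨a', b', c', ha', hb', hc', rfl⟩ := hy
      exact ⟨a + a', b + b', c + c', by omega, by omega, by omega, by module⟩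
  · rintro ⟨a, b, c, ha, hb, hc, rfl⟩
    lift a to ℕ using ha
    lift b to ℕ using hb
    lift c to ℕ using hc
    simp only [natCast_zsmul]
    refine add_mem (add_mem ?_ ?_) ?_ <;> apply nsmul_mem <;>
      apply AddSubmonoid.subset_closure <;> simp

theorem wpl_mk (p : Fin 3 → ℕ) (a b c : ℤ) :
    a • wplX p 0 + b • wplX p 1 + c • wplX p 2 =
      (QuotientAddGroup.mk (![a, b, c]) : WPLGroup p) := by
  have : (![a, b, c] : Fin 3 → ℤ) = a • Pi.single (0 : Fin 3) (1 : ℤ) +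
      b • Pi.single (1 : Fin 3) (1 : ℤ) + c • Pi.single (2 : Fin 3) (1 : ℤ) := by
    ext i; fin_cases i <;> simp
  rw [this]
  rfl

theorem wpl_eq_zero (p : Fin 3 → ℕ) (a b c : ℤ) :
    a • wplX p 0 + b • wplX p 1 + c • wplX p 2 = 0 ↔
      ∃ m n : ℤ, a = m * p 0 ∧ b = (n - m) * p 1 ∧ c = - n * p 2 := by
  rw [wpl_mk, QuotientAddGroup.eq_zero_iff, wplRel, AddSubgroup.mem_closure_pair]
  refine exists_congr fun m => exists_congr fun n => ?_
  rw [funext_iff]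
  simp [Fin.forall_fin_succ]
  constructor <;> rintro ⟨h1, h2, h3⟩ <;> refine ⟨?_, ?_, ?_⟩ <;> linarith

/-- In `𝕃(p₁,p₂,p₃)` one has
`2ω⃗ + c⃗ = (p₁−2)x⃗₁ + (p₂−2)x⃗₂ + (p₃−2)x⃗₃`, and the interval `{x : 0 ≤ x ≤ 2ω⃗ + c⃗}`
(where `x ≤ y` iff `y − x ∈ 𝕃₊`) equals
`{l₁x⃗₁ + l₂x⃗₂ + l₃x⃗₃ : 0 ≤ lᵢ ≤ pᵢ − 2}`. -/
theorem interval_zero_two_omega_add_c (p : Fin 3 → ℕ) (hp : ∀ i, 2 ≤ p i) :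
    2 • wplOmega p + wplC p =
      ((p 0 : ℤ) - 2) • wplX p 0 + ((p 1 : ℤ) - 2) • wplX p 1 + ((p 2 : ℤ) - 2) • wplX p 2 ∧
    ∀ x : WPLGroup p,
      (x ∈ wplPos p ∧ (2 • wplOmega p + wplC p) - x ∈ wplPos p) ↔
      ∃ l₁ l₂ l₃ : ℤ,
        (0 ≤ l₁ ∧ l₁ ≤ (p 0 : ℤ) - 2) ∧
        (0 ≤ l₂ ∧ l₂ ≤ (p 1 : ℤ) - 2) ∧
        (0 ≤ l₃ ∧ l₃ ≤ (p 2 : ℤ) - 2) ∧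
        x = l₁ • wplX p 0 + l₂ • wplX p 1 + l₃ • wplX p 2 := by
  have h1 : (p 0 : ℤ) • wplX p 0 + (-(p 1 : ℤ)) • wplX p 1 + (0 : ℤ) • wplX p 2 = 0 :=
    (wpl_eq_zero p _ _ _).2 ⟨1, 0, by ring, by ring, by ring⟩
  have h2 : (0 : ℤ) • wplX p 0 + (p 1 : ℤ) • wplX p 1 + (-(p 2 : ℤ)) • wplX p 2 = 0 :=
    (wpl_eq_zero p _ _ _).2 ⟨0, 1, by ring, by ring, by ring⟩
  have key : 2 • wplOmega p + wplC p =
      ((p 0 : ℤ) - 2) • wplX p 0 + ((p 1 : ℤ) - 2) • wplX p 1 + ((p 2 : ℤ) - 2) • wplX p 2 := by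
    unfold wplOmega wplC
    linear_combination (norm := module) (2 : ℤ) • h1 + h2
  refine ⟨key, fun x => ?_⟩
  rw [key, wplPos_iff, wplPos_iff]
  constructor
  · rintro ⟨⟨a, b, c, ha, hb, hc, rfl⟩, a', b', c', ha', hb', hc', h⟩
    have h0 : (a + a' - (p 0 - 2)) • wplX p 0 + (b + b' - (p 1 - 2)) • wplX p 1 +
        (c + c' - (p 2 - 2)) • wplX p 2 = 0 := by
      linear_combination (norm := module) (-1 : ℤ) • h
    obtain ⟨m, n, e0, e1, e2⟩ := (wpl_eq_zero p _ _ _).1 h0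
    have aux : ∀ (k : ℤ) (q : ℕ) (s : ℤ), 0 ≤ s → s - (q - 2) = k * q → 0 ≤ k := by
      intro k q s hs e
      by_contra hk
      have : k ≤ -1 := by omega
      nlinarith
    have k0 := aux _ _ _ (by omega) e0
    have k1 := aux _ _ _ (by omega) e1
    have k2 := aux _ _ _ (by omega) e2
    obtain rfl : m = 0 := by omega
    obtain rfl : n = 0 := by omega
    simp only [sub_self, neg_zero, zero_mul] at e0 e1 e2
    exact ⟨a, b, c, by omega, by omega, by omega, rfl⟩
  · rintro ⟨a, b, c, ha, hb, hc, rfl⟩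
    exact ⟨⟨a, b, c, ha.1, hb.1, hc.1, rfl⟩, p 0 - 2 - a, p 1 - 2 - b, p 2 - 2 - c,
      by omega, by omega, by omega, by module⟩
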